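/- Let k ≥ 2 be an integer and r > 0, 0 < ε < 1 constants. With high probability, every nonempty induced subhypergraph of HG(n, ⌈r n ln n⌉, k) has average degree at most (1 + ε) k r ln n; equivalently, whp every nonempty subset V' of vertices contains at most (1 + ε) r ln n · |V'| hyperedges. -/

import Mathlib

/-- Sample space for the random `k`-uniform multihypergraph `HG(n,m,k)`: each of the `m`
hyperedges is a `k`-element subset of `[n]`, chosen independently and uniformly. -/
abbrev HGOmega (n m k : ℕ) := Fin m → {S : Finset (Fin n) // S.card = k}

/-- The probability of an event under the uniform distribution on `HGOmega n m k`. -/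
noncomputable def hgPr (n m k : ℕ) (E : HGOmega n m k → Prop) : ℝ :=
  haveI : DecidablePred E := Classical.decPred E
  ((Finset.univ.filter E).card : ℝ) / (Fintype.card (HGOmega n m k) : ℝ)

open Finset in
theorem sum_pow_card_filter {α : Type*} [Fintype α] (P : α → Prop) [DecidablePred P] (m : ℕ)
    (z : ℝ) :
    ∑ ω : Fin m → α, z ^ #{j | P (ω j)} =
      (Fintype.card α + #{a | P a} * (z - 1)) ^ m := by
  have h : ∑ a, (if P a then z else 1) = Fintype.card α + #{a | P a} * (z - 1) := by
    have h1 : ∀ a, (if P a then z else 1) = 1 + (if P a then z - 1 else 0) := by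
      intro a; split_ifs <;> ring
    simp only [h1, sum_add_distrib, ← sum_filter, sum_const, card_univ, nsmul_eq_mul, mul_one]
  rw [← h, Fintype.sum_pow]
  refine sum_congr rfl fun ω _ => ?_
  rw [prod_ite, prod_const, prod_const_one, mul_one]

open Finset in
/-- Chernoff bound for `m` independent uniform trials, in counting form. -/
theorem card_filter_lt_card_filter_le {α : Type*} [Fintype α] [Nonempty α] (P : α → Prop)
    [DecidablePred P] (m : ℕ) (t c p : ℝ) (hc : 0 ≤ c)
    (hp : (#{a | P a} : ℝ) ≤ p * Fintype.card α) :
    (#{ω : Fin m → α | t < (#{j | P (ω j)} : ℝ)} : ℝ) ≤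
      Fintype.card (Fin m → α) * Real.exp (m * (p * (Real.exp c - 1)) - c * t) := by
  have hN : (0 : ℝ) < Fintype.card α := by exact_mod_cast Fintype.card_pos
  have hz : 0 ≤ Real.exp c - 1 := by linarith [Real.one_le_exp hc]
  have markov : (#{ω : Fin m → α | t < (#{j | P (ω j)} : ℝ)} : ℝ) * Real.exp (c * t) ≤
      ∑ ω : Fin m → α, Real.exp c ^ #{j | P (ω j)} := by
    rw [← nsmul_eq_mul, ← sum_const]
    refine (sum_le_sum fun ω hω => ?_).trans
      (sum_le_sum_of_subset_of_nonneg (filter_subset _ _) fun _ _ _ => by positivity)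
    rw [← Real.exp_nat_mul, mul_comm c]
    exact Real.exp_le_exp.2 (mul_le_mul_of_nonneg_right (mem_filter.1 hω).2.le hc)
  have bound : (Fintype.card α + #{a | P a} * (Real.exp c - 1)) ^ m ≤
      Fintype.card (Fin m → α) * Real.exp (m * (p * (Real.exp c - 1))) := by
    rw [Fintype.card_fun, Fintype.card_fin, Nat.cast_pow, Real.exp_nat_mul, ← mul_pow]
    refine pow_le_pow_left₀ (by positivity) ?_ m
    calc (Fintype.card α + #{a | P a} * (Real.exp c - 1) : ℝ)
        ≤ Fintype.card α * (p * (Real.exp c - 1) + 1) := by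
          nlinarith [mul_le_mul_of_nonneg_right hp hz]
      _ ≤ _ := mul_le_mul_of_nonneg_left (Real.add_one_le_exp _) hN.le
  rw [sum_pow_card_filter] at markov
  rw [Real.exp_sub, ← mul_div_assoc, le_div_iff₀ (Real.exp_pos _)]
  exact markov.trans bound

theorem Nat.descFactorial_mul_pow_le {v n : ℕ} (h : v ≤ n) (k : ℕ) :
    v.descFactorial k * n ^ k ≤ n.descFactorial k * v ^ k := by
  induction k with
  | zero => simp
  | succ k ih =>
    have h1 : (v - k) * n ≤ (n - k) * v := by
      rw [Nat.sub_mul, Nat.sub_mul, mul_comm v n]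
      exact Nat.sub_le_sub_left (Nat.mul_le_mul_left k h) _
    rw [Nat.descFactorial_succ, Nat.descFactorial_succ, pow_succ, pow_succ]
    calc _ = ((v - k) * n) * (v.descFactorial k * n ^ k) := by ring
      _ ≤ ((n - k) * v) * (n.descFactorial k * v ^ k) := Nat.mul_le_mul h1 ih
      _ = _ := by ring

theorem Nat.choose_le_div_sq_mul_choose {v n k : ℕ} (hk : 2 ≤ k) (hn : 0 < n) (h : v ≤ n) :
    (v.choose k : ℝ) ≤ ((v : ℝ) / n) ^ 2 * n.choose k := by
  have hn' : (0 : ℝ) < n := by exact_mod_cast hn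
  have h1 : v.choose k * n ^ k ≤ n.choose k * v ^ k := by
    have := Nat.descFactorial_mul_pow_le h k
    rw [Nat.descFactorial_eq_factorial_mul_choose, Nat.descFactorial_eq_factorial_mul_choose,
      mul_assoc, mul_assoc] at this
    exact Nat.le_of_mul_le_mul_left this k.factorial_pos
  have h2 : (v.choose k : ℝ) * n ^ k ≤ n.choose k * v ^ k := by exact_mod_cast h1
  calc (v.choose k : ℝ) ≤ n.choose k * v ^ k / n ^ k := (le_div_iff₀ (by positivity)).2 h2
    _ = ((v : ℝ) / n) ^ k * n.choose k := by rw [div_pow]; ring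
    _ ≤ _ := by
      refine mul_le_mul_of_nonneg_right ?_ (by positivity)
      exact pow_le_pow_of_le_one (by positivity)
        ((div_le_one hn').2 (by exact_mod_cast h)) hk

theorem Nat.choose_le_exp {v n : ℕ} (hv : 0 < v) (hn : 0 < n) :
    (n.choose v : ℝ) ≤ Real.exp (v * (1 + Real.log (n / v))) := by
  have hv' : (0 : ℝ) < v := by exact_mod_cast hv
  have hn' : (0 : ℝ) < n := by exact_mod_cast hn
  have h1 := Real.pow_div_factorial_le_exp (v : ℝ) hv'.le v
  rw [mul_add, mul_one, Real.exp_add, Real.exp_nat_mul (Real.log _), Real.exp_log (by positivity)]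
  calc (n.choose v : ℝ) ≤ n ^ v / v.factorial := Nat.choose_le_pow_div v n
    _ = v ^ v / v.factorial * (n / v) ^ v := by rw [div_pow]; field_simp
    _ ≤ _ := mul_le_mul_of_nonneg_right h1 (by positivity)

open Finset in
theorem card_filter_subset_le_choose {n k : ℕ} (V : Finset (Fin n)) :
    #{S : {S : Finset (Fin n) // S.card = k} | S.1 ⊆ V} ≤ (#V).choose k := by
  rw [← card_powersetCard]
  refine card_le_card_of_injOn Subtype.val (fun S hS => ?_) Subtype.val_injective.injOn
  simp only [coe_filter, mem_univ, true_and, Set.mem_ofPred_eq] at hS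
  exact mem_coe.2 (mem_powersetCard.2 ⟨hS, S.2⟩)

/-- The Chernoff exponent at parameter `log ((1 + ε) / x)`, where `x = v / n`. -/
theorem chernoff_exponent_le {ε L v n m : ℝ} (hε0 : 0 < ε) (hε1 : ε < 1) (hL : 0 ≤ L)
    (hv : 0 < v) (hvn : v ≤ n) (hm : m ≤ n * L + 1) :
    m * ((v / n) ^ 2 * (Real.exp (Real.log ((1 + ε) * (n / v))) - 1)) -
        Real.log ((1 + ε) * (n / v)) * ((1 + ε) * L * v) ≤
      2 - min ((1 + ε) * Real.log (1 + ε) - ε) ε * L * (v * (1 + Real.log (n / v))) := by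
  have hn : 0 < n := hv.trans_le hvn
  have hnv : 1 ≤ n / v := (one_le_div hv).2 hvn
  set s := Real.log (n / v) with hs
  set δ := min ((1 + ε) * Real.log (1 + ε) - ε) ε with hδ
  have hs0 : 0 ≤ s := Real.log_nonneg hnv
  have hx : 1 - s ≤ v / n := by
    have := Real.add_one_le_exp (-s)
    rw [Real.exp_neg, hs, Real.exp_log (by positivity), inv_div, ← hs] at this
    linarith
  have hx1 : v / n ≤ 1 := (div_le_one hn).2 hvn
  have hx0 : 0 < v / n := by positivity
  rw [Real.exp_log (by positivity), Real.log_mul (by positivity) (by positivity), ← hs]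
  have e1 : (v / n) ^ 2 * ((1 + ε) * (n / v) - 1) = (v / n) * ((1 + ε) - v / n) := by
    field_simp
  have e2 : (n * L + 1) * ((v / n) * ((1 + ε) - v / n)) =
      L * v * ((1 + ε) - v / n) + (v / n) * ((1 + ε) - v / n) := by
    field_simp
  have h1 : m * ((v / n) * ((1 + ε) - v / n)) ≤ (n * L + 1) * ((v / n) * ((1 + ε) - v / n)) :=
    mul_le_mul_of_nonneg_right hm (mul_nonneg hx0.le (by linarith))
  have h2 : (v / n) * ((1 + ε) - v / n) ≤ 2 := by nlinarith
  have hLv : 0 ≤ L * v := by positivity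
  have h3 : ((1 + ε) - v / n) - (Real.log (1 + ε) + s) * (1 + ε) ≤ -(δ * (1 + s)) := by
    have d1 : δ ≤ (1 + ε) * Real.log (1 + ε) - ε := min_le_left _ _
    have d2 : δ * s ≤ ε * s := mul_le_mul_of_nonneg_right (min_le_right _ _) hs0
    linarith
  have h4 := mul_le_mul_of_nonneg_left h3 hLv
  rw [e1]
  linarith

open Finset in
theorem card_dense_le {n k : ℕ} (hk : 2 ≤ k) (hkn : k ≤ n) {r ε : ℝ} (hr : 0 < r) (hε0 : 0 < ε)
    (hε1 : ε < 1) (V : Finset (Fin n)) (hV : V.Nonempty) :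
    (#{ω : HGOmega n ⌈r * n * Real.log n⌉₊ k |
        (1 + ε) * r * Real.log n * #V < (#{j | (ω j).1 ⊆ V} : ℝ)} : ℝ) ≤
      Fintype.card (HGOmega n ⌈r * n * Real.log n⌉₊ k) *
        Real.exp (2 - min ((1 + ε) * Real.log (1 + ε) - ε) ε * (r * Real.log n) *
          (#V * (1 + Real.log (n / #V)))) := by
  have hcard : Fintype.card {S : Finset (Fin n) // S.card = k} = n.choose k := by
    rw [Fintype.card_finset_len, Fintype.card_fin]
  have : Nonempty {S : Finset (Fin n) // S.card = k} := by
    rw [← Fintype.card_pos_iff, hcard]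
    exact Nat.choose_pos hkn
  have hn : 0 < n := by omega
  have hVn : #V ≤ n := by simpa using card_le_univ V
  have hV0 : (0 : ℝ) < #V := by exact_mod_cast hV.card_pos
  have hVn' : (#V : ℝ) ≤ n := by exact_mod_cast hVn
  have hlog : 0 ≤ Real.log n := Real.log_natCast_nonneg n
  refine (card_filter_lt_card_filter_le (fun S : {S : Finset (Fin n) // S.card = k} => S.1 ⊆ V)
    ⌈r * n * Real.log n⌉₊ _ (Real.log ((1 + ε) * (n / #V))) ((#V / n : ℝ) ^ 2) ?_ ?_).trans ?_
  · refine Real.log_nonneg ?_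
    have : 1 ≤ (n : ℝ) / #V := (one_le_div hV0).2 hVn'
    nlinarith
  · rw [hcard]
    exact (Nat.cast_le.2 (card_filter_subset_le_choose V)).trans
      (Nat.choose_le_div_sq_mul_choose hk hn hVn)
  · refine mul_le_mul_of_nonneg_left (Real.exp_le_exp.2 ?_) (by positivity)
    have hm : (⌈r * n * Real.log n⌉₊ : ℝ) ≤ n * (r * Real.log n) + 1 := by
      have := (Nat.ceil_lt_add_one (show 0 ≤ r * n * Real.log n by positivity)).le
      linarith
    have := chernoff_exponent_le hε0 hε1 (show 0 ≤ r * Real.log n by positivity) hV0 hVn' hm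
    simpa only [mul_assoc] using this

open Finset in
theorem sum_nonempty_exp_le {n : ℕ} (hn : 0 < n) {a : ℝ} (ha : 2 ≤ a) :
    ∑ V : Finset (Fin n) with V.Nonempty, Real.exp (2 - a * (#V * (1 + Real.log (n / #V)))) ≤
      2 * Real.exp (3 - a) := by
  have hq : Real.exp (1 - a) ≤ 1 / 2 := by
    have h1 : Real.exp (1 - a) ≤ Real.exp (-1) := Real.exp_le_exp.2 (by linarith)
    have h2 : Real.exp (-1) ≤ 1 / 2 := by
      rw [Real.exp_neg, one_div]
      exact inv_anti₀ (by norm_num) (by linarith [Real.add_one_le_exp (1 : ℝ)])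
    exact h1.trans h2
  set q := Real.exp (1 - a) with hqdef
  have hq0 : 0 < q := Real.exp_pos _
  set f : ℕ → ℝ := fun v =>
    if 0 < v then Real.exp (2 - a * (v * (1 + Real.log (n / v)))) else 0 with hf
  have hterm : ∀ v ∈ range n, (n.choose (v + 1) : ℝ) * f (v + 1) ≤ Real.exp 2 * q * q ^ v := by
    intro v hv
    have hvn : v + 1 ≤ n := mem_range.1 hv
    have hv0 : (0 : ℝ) < (v + 1 : ℕ) := by positivity
    have hs : 0 ≤ Real.log ((n : ℝ) / (v + 1 : ℕ)) :=
      Real.log_nonneg ((one_le_div hv0).2 (by exact_mod_cast hvn))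
    have hc := Nat.choose_le_exp (Nat.succ_pos v) hn
    simp only [hf, Nat.succ_pos, if_true]
    refine (mul_le_mul_of_nonneg_right hc (Real.exp_pos _).le).trans ?_
    rw [mul_assoc, ← pow_succ', hqdef, ← Real.exp_nat_mul, ← Real.exp_add, ← Real.exp_add]
    refine Real.exp_le_exp.2 ?_
    have : 0 ≤ (a - 1) * (((v + 1 : ℕ) : ℝ) * Real.log ((n : ℝ) / (v + 1 : ℕ))) :=
      mul_nonneg (by linarith) (mul_nonneg hv0.le hs)
    simp only [Nat.succ_eq_add_one]
    linarith
  calc ∑ V : Finset (Fin n) with V.Nonempty, Real.exp (2 - a * (#V * (1 + Real.log (n / #V))))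
      = ∑ V ∈ (univ : Finset (Fin n)).powerset, f #V := by
        simp only [hf, sum_filter, powerset_univ, card_pos]
    _ = ∑ v ∈ range (n + 1), (n.choose v : ℝ) * f v := by
        rw [sum_powerset_apply_card]; simp
    _ = ∑ v ∈ range n, (n.choose (v + 1) : ℝ) * f (v + 1) := by
        rw [sum_range_succ']; simp [hf]
    _ ≤ ∑ v ∈ range n, Real.exp 2 * q * q ^ v := sum_le_sum hterm
    _ ≤ Real.exp 2 * q * 2 := by
        rw [← mul_sum]
        refine mul_le_mul_of_nonneg_left ?_ (by positivity)
        calc ∑ v ∈ range n, q ^ v ≤ ∑ v ∈ range n, (1 / 2 : ℝ) ^ v :=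
              sum_le_sum fun v _ => pow_le_pow_left₀ hq0.le hq v
          _ ≤ 2 := sum_geometric_two_le n
    _ = 2 * Real.exp (3 - a) := by
        rw [hqdef, ← Real.exp_add]; ring_nf

theorem sub_pos_one_add_mul_log {ε : ℝ} (hε0 : 0 < ε) :
    0 < (1 + ε) * Real.log (1 + ε) - ε := by
  have h := Real.log_lt_sub_one_of_pos (x := (1 + ε)⁻¹) (by positivity)
    (by rw [ne_eq, inv_eq_one]; linarith)
  rw [Real.log_inv] at h
  have h2 : (1 + ε) * ((1 + ε)⁻¹ - 1) = -ε := by field_simp; ring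
  nlinarith [mul_lt_mul_of_pos_left h (show 0 < 1 + ε by linarith)]

theorem hgPr_le_one (n m k : ℕ) (E : HGOmega n m k → Prop) : hgPr n m k E ≤ 1 := by
  classical
  exact div_le_one_of_le₀ (by exact_mod_cast Finset.card_le_univ _) (by positivity)

open Finset in
/-- The union bound over all nonempty vertex subsets. -/
theorem one_sub_le_hgPr {n k : ℕ} (hk : 2 ≤ k) (hkn : k ≤ n) {r ε : ℝ} (hr : 0 < r)
    (hε0 : 0 < ε) (hε1 : ε < 1)
    (ha : 2 ≤ min ((1 + ε) * Real.log (1 + ε) - ε) ε * (r * Real.log n)) :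
    1 - 2 * Real.exp (3 - min ((1 + ε) * Real.log (1 + ε) - ε) ε * (r * Real.log n)) ≤
      hgPr n ⌈r * n * Real.log n⌉₊ k
        (fun ω => ∀ V' : Finset (Fin n), V'.Nonempty →
          ((Finset.univ.filter (fun j => (ω j).1 ⊆ V')).card : ℝ) ≤
            (1 + ε) * r * Real.log n * V'.card) := by
  classical
  set m := ⌈r * n * Real.log n⌉₊
  set a := min ((1 + ε) * Real.log (1 + ε) - ε) ε * (r * Real.log n)
  set E : HGOmega n m k → Prop := fun ω => ∀ V' : Finset (Fin n), V'.Nonempty →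
          ((Finset.univ.filter (fun j => (ω j).1 ⊆ V')).card : ℝ) ≤
            (1 + ε) * r * Real.log n * V'.card with hE
  have hN : (0 : ℝ) < Fintype.card (HGOmega n m k) := by
    rw [Fintype.card_fun, Fintype.card_finset_len, Fintype.card_fin]
    exact_mod_cast pow_pos (Nat.choose_pos hkn) _
  have hbad : (#{ω | ¬ E ω} : ℝ) ≤ Fintype.card (HGOmega n m k) * (2 * Real.exp (3 - a)) := by
    have hsub : ({ω | ¬ E ω} : Finset (HGOmega n m k)) ⊆
        ({V : Finset (Fin n) | V.Nonempty} : Finset _).biUnion fun V =>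
          {ω | (1 + ε) * r * Real.log n * #V < (#{j | (ω j).1 ⊆ V} : ℝ)} := by
      intro ω hω
      simpa [hE] using hω
    calc (#{ω | ¬ E ω} : ℝ)
        ≤ ∑ V : Finset (Fin n) with V.Nonempty, (#{ω : HGOmega n m k |
            (1 + ε) * r * Real.log n * #V < (#{j | (ω j).1 ⊆ V} : ℝ)} : ℝ) := by
          exact_mod_cast (card_le_card hsub).trans card_biUnion_le
      _ ≤ ∑ V : Finset (Fin n) with V.Nonempty, Fintype.card (HGOmega n m k) *
            Real.exp (2 - a * (#V * (1 + Real.log (n / #V)))) :=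
          sum_le_sum fun V hV => card_dense_le hk hkn hr hε0 hε1 V (mem_filter.1 hV).2
      _ ≤ _ := by
          rw [← mul_sum]
          exact mul_le_mul_of_nonneg_left (sum_nonempty_exp_le (by omega) ha) hN.le
  have hsplit : (#{ω | E ω} : ℝ) + #{ω | ¬ E ω} = Fintype.card (HGOmega n m k) := by
    exact_mod_cast card_filter_add_card_filter_not (s := univ) E
  have hpr : hgPr n m k E = (#{ω | E ω} : ℝ) / Fintype.card (HGOmega n m k) := by
    unfold hgPr
    congr!
  rw [hpr, le_div_iff₀ hN]
  linarith

/-- For `k ≥ 2`, `r > 0` and `0 < ε < 1`, with high probability every nonempty induced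
subhypergraph of `HG(n, ⌈r n ln n⌉, k)` has average degree at most `(1 + ε) k r ln n`;
equivalently, every nonempty vertex subset `V'` contains at most `(1 + ε) r ln n · |V'|`
hyperedges. -/
theorem hg_avg_degree_upper (k : ℕ) (hk : 2 ≤ k) (r ε : ℝ) (hr : 0 < r) (hε0 : 0 < ε)
    (hε1 : ε < 1) :
    Filter.Tendsto
      (fun n : ℕ => hgPr n ⌈r * n * Real.log n⌉₊ k
        (fun ω => ∀ V' : Finset (Fin n), V'.Nonempty →
          ((Finset.univ.filter (fun j => (ω j).1 ⊆ V')).card : ℝ) ≤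
            (1 + ε) * r * Real.log n * V'.card))
      Filter.atTop (nhds 1) := by
  have hδ : 0 < min ((1 + ε) * Real.log (1 + ε) - ε) ε :=
    lt_min (sub_pos_one_add_mul_log hε0) hε0
  have ha : Filter.Tendsto (fun n : ℕ =>
      min ((1 + ε) * Real.log (1 + ε) - ε) ε * (r * Real.log n)) Filter.atTop Filter.atTop :=
    ((Real.tendsto_log_atTop.comp tendsto_natCast_atTop_atTop).const_mul_atTop hr).const_mul_atTop
      hδ
  have hlow : Filter.Tendsto (fun n : ℕ =>
      1 - 2 * Real.exp (3 - min ((1 + ε) * Real.log (1 + ε) - ε) ε * (r * Real.log n)))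
      Filter.atTop (nhds 1) := by
    have h3 := Filter.tendsto_atBot_add_const_left Filter.atTop (3 : ℝ)
      (Filter.tendsto_neg_atTop_atBot.comp ha)
    simpa [Function.comp_def, sub_eq_add_neg] using
      ((Real.tendsto_exp_atBot.comp h3).const_mul 2).const_sub 1
  refine tendsto_of_tendsto_of_tendsto_of_le_of_le' hlow tendsto_const_nhds ?_
    (Filter.Eventually.of_forall fun n => hgPr_le_one _ _ _ _)
  filter_upwards [ha.eventually_ge_atTop 2, Filter.eventually_ge_atTop k] with n h2 hkn
  exact one_sub_le_hgPr hk hkn hr hε0 hε1 h2
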